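/- arXiv:1512.01932 — 3 statements merged into one kernel-verified Lean document; each statement's English description precedes it below -/
import Mathlib

section
/- Let F be a finite field with q elements, let A₃* denote the set of nonnegative integers none of whose base-3 digits equals 2, and let G be the set of nonzero polynomials in F[X] all of whose irreducible-factor multiplicities lie in A₃*. Then G has asymptotic density equal to (1 − 1/q) · ∏_{i=1}^∞ (1 − q^(1−2·3^i))/(1 − q^(1−3^i)); that is, the limit as N → ∞ of |{f ∈ G : deg f ≤ N}| / q^(N+1) exists and equals this product. -/
/-- `A3` is the set of nonnegative integers none of whose base-3 digits equals 2. -/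
def A3 : Set ℕ := {n : ℕ | ∀ d ∈ Nat.digits 3 n, d ≠ 2}

/-- Every monic irreducible factor of `f` occurs with multiplicity lying in `A3`. -/
def GoodMult {F : Type*} [Field F] (f : Polynomial F) : Prop :=
  ∀ P : Polynomial F, P.Monic → Irreducible P →
    ∀ k : ℕ, P ^ k ∣ f → ¬ P ^ (k + 1) ∣ f → k ∈ A3

open Polynomial UniqueFactorizationMonoid

section FactorCount

variable {F : Type*} [Field F]

open scoped Classical in
/-- The number of occurrences of `P` among the normalized irreducible factors of `f`. -/
noncomputable def factorCount (f P : F[X]) : ℕ :=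
  (normalizedFactors f).count P

theorem factorCount_mul {f g : F[X]} (hf : f ≠ 0) (hg : g ≠ 0) (P : F[X]) :
    factorCount (f * g) P = factorCount f P + factorCount g P := by
  classical
  simp [factorCount, normalizedFactors_mul hf hg]

theorem factorCount_pow (f : F[X]) (n : ℕ) (P : F[X]) :
    factorCount (f ^ n) P = n * factorCount f P := by
  simp [factorCount, normalizedFactors_pow]

theorem factorCount_C_mul {c : F} (hc : c ≠ 0) (f P : F[X]) :
    factorCount (C c * f) P = factorCount f P := by
  classical
  have h : Associated (C c * f) f := associated_unit_mul_left f (C c) (isUnit_C.mpr hc.isUnit)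
  unfold factorCount
  by_cases hf : f = 0
  · simp [hf]
  · rw [(associated_iff_normalizedFactors_eq_normalizedFactors
      (mul_ne_zero (C_ne_zero.mpr hc) hf) hf).mp h]

theorem Polynomial.Monic.eq_of_factorCount_eq {f g : F[X]} (hf : f.Monic) (hg : g.Monic)
    (h : ∀ P, factorCount f P = factorCount g P) : f = g := by
  classical
  refine Polynomial.eq_of_monic_of_associated hf hg ?_
  rw [associated_iff_normalizedFactors_eq_normalizedFactors hf.ne_zero hg.ne_zero]
  exact Multiset.ext.mpr h

theorem exists_monic_factorCount_eq_comp {f : F[X]} (hf : f ≠ 0) (φ : ℕ → ℕ) (hφ : φ 0 = 0) :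
    ∃ g : F[X], g.Monic ∧ ∀ P, factorCount g P = φ (factorCount f P) := by
  classical
  set m := Finsupp.toMultiset ((Multiset.toFinsupp (normalizedFactors f)).mapRange φ hφ) with hm
  have hcount (P : F[X]) : m.count P = φ ((normalizedFactors f).count P) := by
    simp [hm, Finsupp.count_toMultiset]
  have hmem (P : F[X]) (hP : P ∈ m) : P ∈ normalizedFactors f := by
    rw [← Multiset.count_pos, hcount] at hP
    by_contra h
    rw [Multiset.count_eq_zero_of_notMem h, hφ] at hP
    exact hP.false
  refine ⟨m.prod, ?_, fun P => ?_⟩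
  · have := monic_multiset_prod_of_monic m id fun P hP =>
      ((Polynomial.mem_normalizedFactors_iff hf).mp (hmem P hP)).2.1
    rwa [Multiset.map_id] at this
  · unfold factorCount
    rw [normalizedFactors_prod_eq m fun P hP => irreducible_of_normalized_factor P (hmem P hP),
      Multiset.map_congr rfl fun P hP => normalize_normalized_factor P (hmem P hP),
      Multiset.map_id', hcount]

theorem goodMult_iff_factorCount {f : F[X]} (hf : f ≠ 0) :
    GoodMult f ↔ ∀ P, factorCount f P ∈ A3 := by
  classical
  have key (P : F[X]) (hP : P.Monic) (hi : Irreducible P) (k : ℕ) :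
      (P ^ k ∣ f ∧ ¬ P ^ (k + 1) ∣ f) ↔ factorCount f P = k := by
    rw [← emultiplicity_eq_coe, emultiplicity_eq_count_normalizedFactors hi hf,
      hP.normalize_eq_self, Nat.cast_inj]
    rfl
  constructor
  · intro h P
    by_cases hP : P ∈ normalizedFactors f
    · have hm := (Polynomial.mem_normalizedFactors_iff hf).mp hP
      have := (key P hm.2.1 hm.1 _).mpr rfl
      exact h P hm.2.1 hm.1 _ this.1 this.2
    · have : factorCount f P = 0 := Multiset.count_eq_zero_of_notMem hP
      rw [this]
      simp [A3]
  · intro h P hP hi k h1 h2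
    exact (key P hP hi k).mp ⟨h1, h2⟩ ▸ h P

end FactorCount

theorem mem_A3_iff (n : ℕ) : n ∈ A3 ↔ n % 3 < 2 ∧ n / 3 ∈ A3 := by
  rcases Nat.eq_zero_or_pos n with rfl | hn
  · simp [A3]
  · simp only [A3, Set.mem_ofPred_eq, Nat.digits_def' (by norm_num : 1 < 3) hn, List.mem_cons,
      forall_eq_or_imp]
    have := Nat.mod_lt n (by norm_num : 0 < 3)
    exact and_congr_left fun _ => by omega

section Counting

variable (F : Type*) [Field F] [Fintype F]

theorem finite_natDegree_le (N : ℕ) : {f : F[X] | f.natDegree ≤ N}.Finite := by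
  have : Finite (degreeLT F (N + 1)) := .of_equiv _ (degreeLTEquiv F (N + 1)).symm.toEquiv
  refine (Set.toFinite (degreeLT F (N + 1) : Set F[X])).subset fun f hf => ?_
  rw [SetLike.mem_coe, mem_degreeLT]
  exact (natDegree_le_iff_degree_le.mp hf).trans_lt (by exact_mod_cast Nat.lt_succ_self N)

/-- The monic polynomials of degree `n` all of whose multiplicities lie in `E`. -/
noncomputable def monicWithMult (E : Set ℕ) (n : ℕ) : Finset F[X] :=
  Set.Finite.toFinset (s := {f | f.Monic ∧ f.natDegree = n ∧ ∀ P, factorCount f P ∈ E})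
    ((finite_natDegree_le F n).subset fun _ hf => hf.2.1.le)

variable {F}

theorem mem_monicWithMult {E : Set ℕ} {n : ℕ} {f : F[X]} :
    f ∈ monicWithMult F E n ↔ f.Monic ∧ f.natDegree = n ∧ ∀ P, factorCount f P ∈ E := by
  simp [monicWithMult]

variable (F)

theorem card_monicWithMult_univ (n : ℕ) :
    (monicWithMult F Set.univ n).card = Fintype.card F ^ n := by
  have e : monicWithMult F Set.univ n ≃ (Fin n → F) :=
    (Equiv.subtypeEquivRight fun f => by simp [mem_monicWithMult]).trans
      ((monicEquivDegreeLT n).trans (degreeLTEquiv F n).toEquiv)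
  classical
  rw [Finset.card_eq_of_equiv_fintype e]
  simp

theorem card_monicWithMult_le (E : Set ℕ) (n : ℕ) :
    (monicWithMult F E n).card ≤ Fintype.card F ^ n := by
  rw [← card_monicWithMult_univ]
  refine Finset.card_le_card fun f hf => ?_
  rw [mem_monicWithMult] at hf ⊢
  exact ⟨hf.1, hf.2.1, fun _ => trivial⟩

theorem card_monicWithMult_zero {E : Set ℕ} (hE : 0 ∈ E) : (monicWithMult F E 0).card = 1 := by
  rw [Finset.card_eq_one]
  refine ⟨1, ?_⟩
  ext f
  rw [mem_monicWithMult, Finset.mem_singleton]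
  constructor
  · rintro ⟨hf, h0, -⟩
    exact hf.natDegree_eq_zero.mp h0
  · rintro rfl
    simp [factorCount, hE]

/-- The coefficient of `X ^ k` in the composition of `∑ c n X ^ n` with `X ^ r`. -/
def expandCoeff {R : Type*} [Zero R] (r : ℕ) (c : ℕ → R) (k : ℕ) : R :=
  if r ∣ k then c (k / r) else 0

theorem card_monicWithMult_eq_sum {E : Set ℕ} {r : ℕ} (hr : 2 ≤ r)
    (hE : ∀ n, n ∈ E ↔ n % r < 2 ∧ n / r ∈ E) (n : ℕ) :
    (monicWithMult F E n).card = ∑ p ∈ Finset.HasAntidiagonal.antidiagonal n,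
      (monicWithMult F {k | k < 2} p.1).card *
        expandCoeff r (fun j => (monicWithMult F E j).card) p.2 := by
  classical
  let T (k : ℕ) : Finset F[X] := if r ∣ k then monicWithMult F E (k / r) else ∅
  have hT (k : ℕ) : expandCoeff r (fun j => (monicWithMult F E j).card) k = (T k).card := by
    unfold expandCoeff T
    split_ifs <;> simp
  have hmemT (k : ℕ) (f : F[X]) :
      f ∈ T k ↔ f.Monic ∧ r * f.natDegree = k ∧ ∀ P, factorCount f P ∈ E := by
    unfold T
    split_ifs with h
    · obtain ⟨j, rfl⟩ := h
      rw [mem_monicWithMult, Nat.mul_div_cancel_left j (by omega), Nat.mul_right_inj (by omega)]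
    · simp only [Finset.notMem_empty, false_iff]
      rintro ⟨-, rfl, -⟩
      exact h (dvd_mul_right ..)
  simp_rw [hT, ← Finset.card_product]
  rw [← Finset.card_sigma]
  symm
  have hcount {a b : F[X]} (ha : a.Monic) (hb : b.Monic) (P : F[X]) :
      factorCount (a * b ^ r) P = factorCount a P + r * factorCount b P := by
    rw [factorCount_mul ha.ne_zero (hb.pow r).ne_zero, factorCount_pow]
  have hmod (x y : ℕ) (hx : x < 2) : (x + r * y) % r = x ∧ (x + r * y) / r = y := by
    rw [Nat.add_mul_mod_self_left, Nat.add_mul_div_left _ _ (by omega),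
      Nat.mod_eq_of_lt (by omega), Nat.div_eq_of_lt (by omega)]
    simp
  refine Finset.card_bij (fun x _ => x.2.1 * x.2.2 ^ r) ?_ ?_ ?_
  · rintro ⟨⟨i, k⟩, a, b⟩ h
    simp only [Finset.mem_sigma, Finset.HasAntidiagonal.mem_antidiagonal,
      Finset.mem_product, mem_monicWithMult, hmemT] at h ⊢
    obtain ⟨rfl, ⟨ha, rfl, ha'⟩, hb, rfl, hb'⟩ := h
    refine ⟨ha.mul (hb.pow r), ?_, fun P => ?_⟩
    · rw [ha.natDegree_mul (hb.pow r), hb.natDegree_pow]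
    · rw [hcount ha hb, hE, (hmod _ _ (ha' P)).1, (hmod _ _ (ha' P)).2]
      exact ⟨ha' P, hb' P⟩
  · rintro ⟨⟨i, k⟩, a, b⟩ h ⟨⟨i', k'⟩, a', b'⟩ h' heq
    simp only [Finset.mem_sigma, Finset.HasAntidiagonal.mem_antidiagonal,
      Finset.mem_product, mem_monicWithMult, hmemT] at h h' heq
    obtain ⟨-, ⟨ha, rfl, hac⟩, hb, rfl, -⟩ := h
    obtain ⟨-, ⟨ha', rfl, hac'⟩, hb', rfl, -⟩ := h'
    have hP (P : F[X]) : factorCount a P = factorCount a' P ∧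
        factorCount b P = factorCount b' P := by
      have h1 := hmod _ (factorCount b P) (hac P)
      have h2 := hmod _ (factorCount b' P) (hac' P)
      rw [← hcount ha hb, heq, hcount ha' hb'] at h1
      exact ⟨h1.1.symm.trans h2.1, h1.2.symm.trans h2.2⟩
    obtain rfl := ha.eq_of_factorCount_eq ha' fun P => (hP P).1
    obtain rfl := hb.eq_of_factorCount_eq hb' fun P => (hP P).2
    rfl
  · intro f hf
    rw [mem_monicWithMult] at hf
    obtain ⟨hf, hn, hfE⟩ := hf
    obtain ⟨a, ha, hac⟩ := exists_monic_factorCount_eq_comp hf.ne_zero (· % r) (by simp)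
    obtain ⟨b, hb, hbc⟩ := exists_monic_factorCount_eq_comp hf.ne_zero (· / r) (by simp)
    have hfab : a * b ^ r = f := (ha.mul (hb.pow r)).eq_of_factorCount_eq hf fun P => by
      rw [hcount ha hb, hac, hbc, Nat.mod_add_div]
    refine ⟨⟨(a.natDegree, r * b.natDegree), a, b⟩, ?_, hfab⟩
    simp only [Finset.mem_sigma, Finset.HasAntidiagonal.mem_antidiagonal,
      Finset.mem_product, mem_monicWithMult, hmemT]
    refine ⟨?_, ⟨ha, trivial, fun P => ?_⟩, hb, trivial, fun P => ?_⟩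
    · rw [← hn, ← hfab, ha.natDegree_mul (hb.pow r), hb.natDegree_pow]
    · rw [hac]
      exact ((hE _).mp (hfE P)).1
    · rw [hbc]
      exact ((hE _).mp (hfE P)).2

theorem ncard_goodMult_natDegree_le (N : ℕ) :
    Set.ncard {f : F[X] | f ≠ 0 ∧ GoodMult f ∧ f.natDegree ≤ N} =
      (Fintype.card F - 1) * ∑ n ∈ Finset.range (N + 1), (monicWithMult F A3 n).card := by
  classical
  rw [← Fintype.card_units, ← Finset.card_univ, ← Finset.card_sigma, ← Finset.card_product,
    ← Set.ncard_coe_finset]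
  symm
  refine Set.ncard_congr (fun x _ => C (x.1 : F) * x.2.2) ?_ ?_ ?_
  · rintro ⟨c, n, f⟩ h
    simp only [Finset.coe_product, Set.mem_prod, Finset.mem_coe, Finset.mem_sigma,
      Finset.mem_range, mem_monicWithMult] at h
    obtain ⟨-, hn, hf, rfl, hfE⟩ := h
    have h0 : C (c : F) * f ≠ 0 := mul_ne_zero (C_ne_zero.mpr c.ne_zero) hf.ne_zero
    refine ⟨h0, (goodMult_iff_factorCount h0).mpr fun P => ?_, ?_⟩
    · rw [factorCount_C_mul c.ne_zero]
      exact hfE P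
    · rw [natDegree_C_mul c.ne_zero]
      exact Nat.le_of_lt_succ hn
  · rintro ⟨c, n, f⟩ ⟨c', n', f'⟩ h h' heq
    simp only [Finset.coe_product, Set.mem_prod, Finset.mem_coe, Finset.mem_sigma,
      Finset.mem_range, mem_monicWithMult] at h h' heq
    obtain ⟨-, -, hf, rfl, -⟩ := h
    obtain ⟨-, -, hf', rfl, -⟩ := h'
    have hc : (c : F) = c' := by
      simpa [hf.leadingCoeff, hf'.leadingCoeff] using congrArg leadingCoeff heq
    obtain rfl := Units.ext hc
    obtain rfl := mul_left_cancel₀ (C_ne_zero.mpr c.ne_zero) heq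
    rfl
  · rintro f ⟨h0, hg, hN⟩
    have hc : f.leadingCoeff ≠ 0 := leadingCoeff_ne_zero.mpr h0
    refine ⟨(Units.mk0 _ hc, ⟨f.natDegree, C f.leadingCoeff⁻¹ * f⟩), ?_, ?_⟩
    · simp only [Finset.coe_product, Set.mem_prod, Finset.mem_coe, Finset.mem_sigma,
        Finset.mem_range, mem_monicWithMult]
      refine ⟨Finset.mem_univ _, Nat.lt_succ_of_le hN, ?_, natDegree_C_mul (inv_ne_zero hc),
        fun P => ?_⟩
      · rw [mul_comm]
        exact monic_mul_leadingCoeff_inv h0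
      · rw [factorCount_C_mul (inv_ne_zero hc)]
        exact (goodMult_iff_factorCount h0).mp hg P
    · simp [← mul_assoc, ← C_mul, hc]

end Counting

section Convolution

open Filter Topology Finset.HasAntidiagonal

theorem hasSum_expandCoeff {r : ℕ} (hr : r ≠ 0) {a : ℕ → ℝ} {x S : ℝ}
    (h : HasSum (fun n => a n * (x ^ r) ^ n) S) :
    HasSum (fun k => expandCoeff r a k * x ^ k) S := by
  have hinj : Function.Injective (r * ·) := mul_right_injective₀ hr
  rw [← hinj.hasSum_iff]
  · convert h using 2 with n
    simp [expandCoeff, Nat.mul_div_cancel_left n (Nat.pos_of_ne_zero hr), pow_mul]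
  · intro k hk
    have : ¬ r ∣ k := fun ⟨j, hj⟩ => hk ⟨j, hj.symm⟩
    simp [expandCoeff, this]

theorem summable_mul_pow_of_le {a : ℕ → ℝ} {q x : ℝ} (ha : ∀ n, 0 ≤ a n)
    (haq : ∀ n, a n ≤ q ^ n) (hq : 0 ≤ q) (hx : 0 ≤ x) (hqx : q * x < 1) :
    Summable fun n => a n * x ^ n := by
  refine .of_nonneg_of_le (fun n => mul_nonneg (ha n) (pow_nonneg hx n)) (fun n => ?_)
    (summable_geometric_of_lt_one (mul_nonneg hq hx) hqx)
  rw [mul_pow]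
  exact mul_le_mul_of_nonneg_right (haq n) (pow_nonneg hx n)

theorem tsum_mul_pow_eq_mul_of_eq_sum_expandCoeff {a s b : ℕ → ℝ} {r : ℕ} (hr : r ≠ 0) {x : ℝ}
    (h : ∀ n, a n = ∑ p ∈ antidiagonal n, s p.1 * expandCoeff r b p.2)
    (hs : Summable fun n => s n * x ^ n) (hb : Summable fun n => b n * (x ^ r) ^ n) :
    ∑' n, a n * x ^ n = (∑' n, s n * x ^ n) * ∑' n, b n * (x ^ r) ^ n := by
  have hb' := hasSum_expandCoeff hr hb.hasSum
  rw [← hb'.tsum_eq,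
    tsum_mul_tsum_eq_tsum_sum_antidiagonal_of_summable_norm hs.norm hb'.summable.norm]
  refine tsum_congr fun n => ?_
  rw [h, Finset.sum_mul]
  refine Finset.sum_congr rfl fun p hp => ?_
  rw [← mem_antidiagonal.mp hp, pow_add]
  ring

theorem tendsto_sum_antidiagonal_mul {h w : ℕ → ℝ} {L W : ℝ} (hh : Tendsto h atTop (𝓝 L))
    (hw : HasSum w W) :
    Tendsto (fun n => ∑ p ∈ antidiagonal n, h p.1 * w p.2) atTop (𝓝 (L * W)) := by
  obtain ⟨C, hC⟩ := (Metric.isBounded_range_of_tendsto h hh).exists_norm_le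
  have hsum (n : ℕ) : ∑ p ∈ antidiagonal n, h p.1 * w p.2 =
      ∑' k, if k ≤ n then h (n - k) * w k else 0 := by
    rw [← Finset.Nat.sum_antidiagonal_swap, tsum_eq_sum (s := Finset.range (n + 1)),
      Finset.Nat.sum_antidiagonal_eq_sum_range_succ_mk]
    · refine Finset.sum_congr rfl fun k hk => ?_
      simp [Nat.le_of_lt_succ (Finset.mem_range.mp hk)]
    · intro k hk
      rw [if_neg fun hkn => hk (Finset.mem_range.mpr (Nat.lt_succ_of_le hkn))]
  simp_rw [hsum]
  rw [← (hw.mul_left L).tsum_eq]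
  refine tendsto_tsum_of_dominated_convergence (bound := fun k => C * ‖w k‖)
    (hw.summable.norm.mul_left C) (fun k => ?_) (Eventually.of_forall fun n k => ?_)
  · refine ((hh.comp (tendsto_sub_atTop_nat k)).mul_const (w k)).congr' ?_
    filter_upwards [eventually_ge_atTop k] with n hn
    simp [hn]
  · split_ifs
    · rw [norm_mul]
      exact mul_le_mul_of_nonneg_right (hC _ ⟨_, rfl⟩) (norm_nonneg _)
    · rw [norm_zero]
      exact mul_nonneg ((norm_nonneg _).trans (hC _ ⟨0, rfl⟩)) (norm_nonneg _)

end Convolution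

section Density

open Filter Topology Finset.HasAntidiagonal

variable (F : Type*) [Field F] [Fintype F]

/-- The number, as a real, of monic polynomials of degree `n` with multiplicities in `E`. -/
noncomputable def monicCount (E : Set ℕ) (n : ℕ) : ℝ :=
  (monicWithMult F E n).card

theorem monicCount_nonneg (E : Set ℕ) (n : ℕ) : 0 ≤ monicCount F E n :=
  Nat.cast_nonneg _

theorem monicCount_le (E : Set ℕ) (n : ℕ) : monicCount F E n ≤ (Fintype.card F : ℝ) ^ n := by
  unfold monicCount
  exact_mod_cast card_monicWithMult_le F E n

theorem monicCount_zero {E : Set ℕ} (hE : 0 ∈ E) : monicCount F E 0 = 1 := by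
  simp [monicCount, card_monicWithMult_zero F hE]

theorem monicCount_univ : monicCount F Set.univ = fun n => (Fintype.card F : ℝ) ^ n := by
  funext n
  simp [monicCount, card_monicWithMult_univ]

theorem monicCount_eq_sum {E : Set ℕ} {r : ℕ} (hr : 2 ≤ r)
    (hE : ∀ n, n ∈ E ↔ n % r < 2 ∧ n / r ∈ E) (n : ℕ) :
    monicCount F E n = ∑ p ∈ antidiagonal n,
      monicCount F {k | k < 2} p.1 * expandCoeff r (monicCount F E) p.2 := by
  unfold monicCount
  rw [card_monicWithMult_eq_sum F hr hE, Nat.cast_sum]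
  refine Finset.sum_congr rfl fun p _ => ?_
  unfold expandCoeff
  split_ifs <;> simp

theorem monicCount_A3_eq_sum (n : ℕ) :
    monicCount F A3 n = ∑ p ∈ antidiagonal n,
      monicCount F {k | k < 2} p.1 * expandCoeff 3 (monicCount F A3) p.2 :=
  monicCount_eq_sum F (by norm_num) mem_A3_iff n

theorem card_pow_eq_sum (n : ℕ) :
    (Fintype.card F : ℝ) ^ n = ∑ p ∈ antidiagonal n,
      monicCount F {k | k < 2} p.1 * expandCoeff 2 (fun j => (Fintype.card F : ℝ) ^ j) p.2 := by
  have := monicCount_eq_sum F (E := Set.univ) le_rfl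
    (fun n => by simp [Nat.le_of_lt_succ (Nat.mod_lt n two_pos)]) n
  rwa [monicCount_univ] at this

theorem one_lt_card_real : 1 < (Fintype.card F : ℝ) := by
  exact_mod_cast Fintype.one_lt_card (α := F)

theorem summable_monicCount (E : Set ℕ) {x : ℝ} (hx : 0 ≤ x) (hqx : Fintype.card F * x < 1) :
    Summable fun n => monicCount F E n * x ^ n :=
  summable_mul_pow_of_le (monicCount_nonneg F E) (monicCount_le F E) (Nat.cast_nonneg _) hx hqx

theorem card_mul_pow_lt_one {x : ℝ} (hx : 0 ≤ x) (hqx : Fintype.card F * x < 1) {r : ℕ}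
    (hr : r ≠ 0) : Fintype.card F * x ^ r < 1 := by
  have hq := one_lt_card_real F
  have hx1 : x ≤ 1 := by nlinarith
  exact (mul_le_mul_of_nonneg_left (pow_le_of_le_one hx hx1 hr) (by positivity)).trans_lt hqx

/-- Squarefree monic polynomials of degree `n` make up a proportion `1 - 1 / q` in the limit. -/
theorem tendsto_monicCount_squarefree :
    Tendsto (fun n => monicCount F {k | k < 2} n / (Fintype.card F : ℝ) ^ n) atTop
      (𝓝 (1 - 1 / (Fintype.card F : ℝ))) := by
  have hq := one_lt_card_real F
  rw [← tendsto_add_atTop_iff_nat 2]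
  refine tendsto_const_nhds.congr fun n => ?_
  have h := card_pow_eq_sum F (n + 2)
  have h' (k : ℕ) : expandCoeff 2 (fun j => (Fintype.card F : ℝ) ^ j) (k + 1 + 1) =
      Fintype.card F * expandCoeff 2 (fun j => (Fintype.card F : ℝ) ^ j) k := by
    unfold expandCoeff
    simp only [show 2 ∣ k + 1 + 1 ↔ 2 ∣ k by omega]
    split_ifs
    · rw [show (k + 1 + 1) / 2 = k / 2 + 1 by omega, pow_succ']
    · simp
  rw [Finset.Nat.sum_antidiagonal_succ', Finset.Nat.sum_antidiagonal_succ'] at h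
  simp only [h', mul_left_comm _ (Fintype.card F : ℝ)] at h
  rw [← Finset.mul_sum, ← card_pow_eq_sum] at h
  simp only [expandCoeff, zero_add, Nat.dvd_one, OfNat.ofNat_ne_one, if_false, mul_zero,
    dvd_zero, if_true, Nat.zero_div, pow_zero, mul_one] at h
  rw [eq_div_iff (by positivity)]
  have hinv : 1 / (Fintype.card F : ℝ) * (Fintype.card F : ℝ) ^ (n + 2) =
      Fintype.card F * (Fintype.card F : ℝ) ^ n := by
    field_simp
    ring
  linear_combination h - hinv

theorem tsum_monicCount_squarefree {x : ℝ} (hx : 0 ≤ x) (hqx : Fintype.card F * x < 1) :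
    ∑' n, monicCount F {k | k < 2} n * x ^ n =
      (1 - Fintype.card F * x ^ 2) / (1 - Fintype.card F * x) := by
  have hgeom {y : ℝ} (hy : 0 ≤ y) (hqy : Fintype.card F * y < 1) :
      HasSum (fun n => (Fintype.card F : ℝ) ^ n * y ^ n) (1 - Fintype.card F * y)⁻¹ := by
    simpa only [mul_pow] using hasSum_geometric_of_lt_one (by positivity) hqy
  have hqx2 := card_mul_pow_lt_one F hx hqx two_ne_zero
  have h2 := hgeom (pow_nonneg hx 2) hqx2
  have h := tsum_mul_pow_eq_mul_of_eq_sum_expandCoeff two_ne_zero (card_pow_eq_sum F)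
    (summable_monicCount F {k | k < 2} hx hqx) h2.summable
  rw [(hgeom hx hqx).tsum_eq, h2.tsum_eq] at h
  have : 1 - Fintype.card F * x ^ 2 ≠ 0 := by linarith
  rw [div_eq_inv_mul, h]
  field_simp

/-- The generating function of the monic polynomials with multiplicities in `A3`. -/
noncomputable def genA3 (x : ℝ) : ℝ :=
  ∑' n, monicCount F A3 n * x ^ n

theorem genA3_eq {x : ℝ} (hx : 0 ≤ x) (hqx : Fintype.card F * x < 1) :
    genA3 F x = (1 - Fintype.card F * x ^ 2) / (1 - Fintype.card F * x) * genA3 F (x ^ 3) := by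
  unfold genA3
  rw [← tsum_monicCount_squarefree F hx hqx]
  exact tsum_mul_pow_eq_mul_of_eq_sum_expandCoeff three_ne_zero (monicCount_A3_eq_sum F)
    (summable_monicCount F _ hx hqx) (summable_monicCount F _ (pow_nonneg hx 3)
      (card_mul_pow_lt_one F hx hqx three_ne_zero))

theorem genA3_eq_prod_mul {x : ℝ} (hx : 0 ≤ x) (hqx : Fintype.card F * x < 1) (m : ℕ) :
    genA3 F x = (∏ i ∈ Finset.range m,
      (1 - Fintype.card F * (x ^ 3 ^ i) ^ 2) / (1 - Fintype.card F * x ^ 3 ^ i)) *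
        genA3 F (x ^ 3 ^ m) := by
  induction m with
  | zero => simp
  | succ m ih =>
    rw [ih, Finset.prod_range_succ, genA3_eq F (pow_nonneg hx _)
      (card_mul_pow_lt_one F hx hqx (by positivity)), ← pow_mul x (3 ^ m) 3, ← pow_succ, mul_assoc]

theorem tendsto_genA3_zero : Tendsto (genA3 F) (𝓝[≥] 0) (𝓝 1) := by
  have hq := one_lt_card_real F
  have hlim : Tendsto (fun x : ℝ => (1 - Fintype.card F * x)⁻¹) (𝓝[≥] 0) (𝓝 1) := by
    have : ContinuousAt (fun x : ℝ => (1 - Fintype.card F * x)⁻¹) 0 :=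
      ContinuousAt.inv₀ (by fun_prop) (by simp)
    simpa [ContinuousAt] using this.mono_left nhdsWithin_le_nhds
  have hsmall : ∀ᶠ x : ℝ in 𝓝[≥] 0, 0 ≤ x ∧ Fintype.card F * x < 1 := by
    refine eventually_mem_nhdsWithin.and (nhdsWithin_le_nhds ?_)
    exact (continuous_const.mul continuous_id).tendsto' 0 0 (by simp) |>.eventually_lt_const
      one_pos
  refine tendsto_of_tendsto_of_tendsto_of_le_of_le' tendsto_const_nhds hlim ?_ ?_
  · filter_upwards [hsmall] with x ⟨hx, hqx⟩
    have := (summable_monicCount F A3 hx hqx).le_tsum 0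
      fun n _ => mul_nonneg (monicCount_nonneg F A3 n) (pow_nonneg hx n)
    rwa [monicCount_zero F (by simp [A3]), pow_zero, mul_one] at this
  · filter_upwards [hsmall] with x ⟨hx, hqx⟩
    have hg := hasSum_geometric_of_lt_one (by positivity) hqx
    refine hasSum_le (fun n => ?_) (summable_monicCount F A3 hx hqx).hasSum hg
    rw [mul_pow]
    exact mul_le_mul_of_nonneg_right (monicCount_le F A3 n) (pow_nonneg hx n)

theorem multipliable_expand_pow {q x : ℝ} (hq : 1 < q) (hx : 0 ≤ x) (hqx : q * x < 1) :
    Multipliable fun i : ℕ => (1 - q * (x ^ 3 ^ i) ^ 2) / (1 - q * x ^ 3 ^ i) := by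
  have hx1 : x < 1 := by nlinarith
  have hle (i : ℕ) : x ^ 3 ^ i ≤ x * x ^ i := by
    rw [← pow_succ']
    exact pow_le_pow_of_le_one hx hx1.le (Nat.lt_pow_self (by norm_num : 1 < 3))
  have hle' (i : ℕ) : x ^ 3 ^ i ≤ x := (hle i).trans
    (mul_le_of_le_one_right hx (pow_le_one₀ hx hx1.le))
  have hden (i : ℕ) : 1 - q * x ≤ 1 - q * x ^ 3 ^ i := by
    have := mul_le_mul_of_nonneg_left (hle' i) (by linarith : 0 ≤ q)
    linarith
  have h : Summable fun i : ℕ =>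
      (q * x ^ 3 ^ i - q * (x ^ 3 ^ i) ^ 2) / (1 - q * x ^ 3 ^ i) := by
    refine .of_nonneg_of_le (fun i => ?_) (fun i => ?_)
      ((summable_geometric_of_lt_one hx hx1).mul_left (q * x / (1 - q * x)))
    · have h0 : 0 ≤ x ^ 3 ^ i := by positivity
      have h1 : 0 ≤ 1 - x ^ 3 ^ i := by linarith [hle' i]
      refine div_nonneg ?_ (by linarith [hden i])
      have : 0 ≤ q * (x ^ 3 ^ i * (1 - x ^ 3 ^ i)) := by positivity
      linarith
    · rw [div_mul_eq_mul_div]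
      refine div_le_div₀ (by positivity) ?_ (by linarith) (hden i)
      have := mul_le_mul_of_nonneg_left (hle i) (by linarith : 0 ≤ q)
      have : 0 ≤ q * (x ^ 3 ^ i) ^ 2 := by positivity
      linarith
  refine (Real.multipliable_one_add_of_summable h).congr fun i => ?_
  have : 1 - q * x ^ 3 ^ i ≠ 0 := by linarith [hden i]
  field_simp
  ring

theorem genA3_eq_tprod {x : ℝ} (hx : 0 ≤ x) (hqx : Fintype.card F * x < 1) :
    genA3 F x = ∏' i : ℕ,
      (1 - Fintype.card F * (x ^ 3 ^ i) ^ 2) / (1 - Fintype.card F * x ^ 3 ^ i) := by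
  have hq := one_lt_card_real F
  have hpow : Tendsto (fun m : ℕ => x ^ 3 ^ m) atTop (𝓝[≥] 0) := by
    refine tendsto_nhdsWithin_iff.mpr ⟨?_, Eventually.of_forall fun m => pow_nonneg hx _⟩
    exact (tendsto_pow_atTop_nhds_zero_of_lt_one hx (by nlinarith)).comp
      (tendsto_pow_atTop_atTop_of_one_lt (by norm_num))
  have h := (multipliable_expand_pow hq hx hqx).tendsto_prod_tprod_nat.mul
    ((tendsto_genA3_zero F).comp hpow)
  rw [mul_one] at h
  exact tendsto_nhds_unique
    (tendsto_const_nhds.congr fun m => genA3_eq_prod_mul F hx hqx m) h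

theorem card_mul_inv_pow_three_lt_one :
    (Fintype.card F : ℝ) * (Fintype.card F : ℝ)⁻¹ ^ 3 < 1 := by
  have hq := one_lt_card_real F
  rw [pow_succ', mul_inv_cancel_left₀ (by positivity)]
  exact pow_lt_one₀ (by positivity) (inv_lt_one_of_one_lt₀ hq) two_ne_zero

theorem tendsto_monicCount_A3 :
    Tendsto (fun n => monicCount F A3 n / (Fintype.card F : ℝ) ^ n) atTop
      (𝓝 ((1 - 1 / (Fintype.card F : ℝ)) * genA3 F ((Fintype.card F : ℝ)⁻¹ ^ 3))) := by
  have hq := one_lt_card_real F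
  have hx : (0 : ℝ) ≤ (Fintype.card F : ℝ)⁻¹ ^ 3 := by positivity
  have hqx : (Fintype.card F : ℝ) * (Fintype.card F : ℝ)⁻¹ ^ 3 < 1 :=
    card_mul_inv_pow_three_lt_one F
  refine (tendsto_sum_antidiagonal_mul (tendsto_monicCount_squarefree F)
    (hasSum_expandCoeff three_ne_zero (summable_monicCount F A3 hx hqx).hasSum)).congr fun n => ?_
  rw [monicCount_A3_eq_sum, Finset.sum_div]
  refine Finset.sum_congr rfl fun p hp => ?_
  rw [← mem_antidiagonal.mp hp, pow_add, inv_pow]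
  field_simp

end Density

theorem stmt_7 (F : Type*) [Field F] [Fintype F] (q : ℕ) (hq : Fintype.card F = q) :
    Filter.Tendsto
      (fun N : ℕ =>
        (Set.ncard {f : Polynomial F | f ≠ 0 ∧ GoodMult f ∧ f.natDegree ≤ N} : ℝ) /
          (q : ℝ) ^ (N + 1))
      Filter.atTop
      (nhds ((1 - 1 / (q : ℝ)) *
        ∏' i : ℕ,
          (1 - (q : ℝ) ^ ((1 : ℤ) - 2 * 3 ^ (i + 1))) /
            (1 - (q : ℝ) ^ ((1 : ℤ) - 3 ^ (i + 1))))) := by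
  subst hq
  have hq := one_lt_card_real F
  have hq0 : (Fintype.card F : ℝ) ≠ 0 := by positivity
  have hx : (0 : ℝ) ≤ (Fintype.card F : ℝ)⁻¹ ^ 3 := by positivity
  have hqx : (Fintype.card F : ℝ) * (Fintype.card F : ℝ)⁻¹ ^ 3 < 1 :=
    card_mul_inv_pow_three_lt_one F
  have hlim : ∏' i : ℕ, (1 - (Fintype.card F : ℝ) ^ ((1 : ℤ) - 2 * 3 ^ (i + 1))) /
      (1 - (Fintype.card F : ℝ) ^ ((1 : ℤ) - 3 ^ (i + 1))) =
        genA3 F ((Fintype.card F : ℝ)⁻¹ ^ 3) := by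
    rw [genA3_eq_tprod F hx hqx]
    refine tprod_congr fun i => ?_
    have hzpow (k : ℕ) : (Fintype.card F : ℝ) ^ ((1 : ℤ) - k) =
        Fintype.card F * (Fintype.card F : ℝ)⁻¹ ^ k := by
      rw [zpow_sub₀ hq0, zpow_one, zpow_natCast, inv_pow, div_eq_mul_inv]
    have h1 := hzpow (2 * 3 ^ (i + 1))
    have h2 := hzpow (3 ^ (i + 1))
    push_cast at h1 h2
    rw [h1, h2, ← pow_mul, ← pow_mul, ← pow_mul, ← mul_assoc, ← pow_succ', mul_comm 2]
  rw [hlim]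
  have hgeom : HasSum (fun n => (Fintype.card F : ℝ)⁻¹ ^ n) (1 - (Fintype.card F : ℝ)⁻¹)⁻¹ :=
    hasSum_geometric_of_lt_one (by positivity) (inv_lt_one_of_one_lt₀ hq)
  have h := (tendsto_sum_antidiagonal_mul (tendsto_monicCount_A3 F) hgeom).const_mul
    (1 - (Fintype.card F : ℝ)⁻¹)
  have hne : 1 - (Fintype.card F : ℝ)⁻¹ ≠ 0 := (sub_pos.mpr (inv_lt_one_of_one_lt₀ hq)).ne'
  rw [mul_comm, mul_assoc, inv_mul_cancel₀ hne, mul_one] at h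
  refine h.congr fun N => ?_
  rw [ncard_goodMult_natDegree_le, Nat.cast_mul, Nat.cast_sub Fintype.card_pos, Nat.cast_one,
    Nat.cast_sum, Finset.Nat.sum_antidiagonal_eq_sum_range_succ_mk, Finset.mul_sum,
    Finset.mul_sum, Finset.sum_div]
  refine Finset.sum_congr rfl fun n hn => ?_
  obtain ⟨k, rfl⟩ := Nat.exists_eq_add_of_le (Nat.le_of_lt_succ (Finset.mem_range.mp hn))
  rw [Nat.add_sub_cancel_left, monicCount, inv_pow, pow_succ, pow_add]
  field_simp
end

section
/- Let F be a finite field with q elements and let A ⊆ F[X] be any set of nonzero polynomials containing no 3-term geometric progression b, r·b, r²·b with b ≠ 0, r ≠ 0, and r not a unit. Then the upper density of A is at most 1 − (q − 1)/(q³ − 1). -/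
open Polynomial in
theorem ncard_degreeLT (F : Type*) [Field F] [Fintype F] (n : ℕ) :
    (degreeLT F n : Set F[X]).ncard = Fintype.card F ^ n := by
  rw [← Nat.card_coe_set_eq]
  refine (Nat.card_congr (degreeLTEquiv F n).toEquiv).trans ?_
  simp

open Polynomial in
theorem finite_degreeLT (F : Type*) [Field F] [Fintype F] (n : ℕ) :
    (degreeLT F n : Set F[X]).Finite :=
  Set.finite_of_ncard_pos (by rw [ncard_degreeLT]; exact pow_pos Fintype.card_pos n)

open Polynomial in
theorem X_pow_mul_mem_degreeLT {F : Type*} [Field F] {n k : ℕ} {f : F[X]}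
    (hf : f ∈ degreeLT F n) : X ^ k * f ∈ degreeLT F (n + k) := by
  rw [mem_degreeLT, degree_lt_iff_coeff_zero] at *
  intro m hm
  rw [coeff_X_pow_mul', if_pos (by omega)]
  exact hf _ (by omega)

open Polynomial in
/-- There are at least `q ^ (n + 1) - q ^ n` polynomials of degree at most `n` with nonzero
constant term. -/
theorem ncard_degreeLT_coeff_zero_ne (F : Type*) [Field F] [Fintype F] (n : ℕ) :
    Fintype.card F ^ (n + 1) ≤
      {f : F[X] | f ∈ degreeLT F (n + 1) ∧ f.coeff 0 ≠ 0}.ncard + Fintype.card F ^ n := by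
  rw [← ncard_degreeLT, ← ncard_degreeLT,
    ← Set.ncard_image_of_injective (degreeLT F n : Set F[X])
      (mul_right_injective₀ (X_ne_zero (R := F)))]
  refine (Set.ncard_le_ncard ?_ (Set.Finite.union ((finite_degreeLT F (n + 1)).subset
    fun f hf ↦ hf.1) ((finite_degreeLT F n).image _))).trans (Set.ncard_union_le _ _)
  intro f hf
  by_cases h0 : f.coeff 0 = 0
  · obtain ⟨g, rfl⟩ := X_dvd_iff.2 h0
    refine .inr ⟨g, ?_, rfl⟩
    simp only [SetLike.mem_coe, mem_degreeLT, degree_lt_iff_coeff_zero] at *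
    intro m hm
    simpa using hf (m + 1) (by omega)
  · exact .inl ⟨hf, h0⟩

open Polynomial in
theorem eq_of_X_pow_mul_eq {F : Type*} [Field F] {f g : F[X]} (hf : f.coeff 0 ≠ 0)
    (hg : g.coeff 0 ≠ 0) {i j : ℕ} (h : X ^ i * f = X ^ j * g) : i = j ∧ f = g := by
  have key : i = j := by
    have hi := congrArg (coeff · i) h
    have hj := congrArg (coeff · j) h
    simp only [coeff_X_pow_mul'] at hi hj
    rcases lt_trichotomy i j with hij | hij | hij
    · simp [hij.not_ge, hf] at hi
    · exact hij
    · simp [hij.not_ge, hg.symm] at hj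
  subst key
  exact ⟨rfl, mul_left_cancel₀ (pow_ne_zero _ X_ne_zero) h⟩

open Polynomial in
/-- If `A` misses a point of every progression `f, X * f, X ^ 2 * f`, then its complement in
degree less than `n + 3` contains a copy of the complement of its pullback under
multiplication by `X ^ 3`, and one more point for every `f` with nonzero constant term. -/
theorem ncard_diff_add_le {F : Type*} [Field F] [Fintype F] (A : Set F[X])
    (hA : ∀ f : F[X], f ≠ 0 → ∃ i < 3, X ^ i * f ∉ A) (n : ℕ) :
    ((degreeLT F n : Set F[X]) \ ((X ^ 3 * ·) ⁻¹' A)).ncard +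
      {f : F[X] | f ∈ degreeLT F (n + 1) ∧ f.coeff 0 ≠ 0}.ncard ≤
    ((degreeLT F (n + 3) : Set F[X]) \ A).ncard := by
  have hne {f : F[X]} (hf : f.coeff 0 ≠ 0) : f ≠ 0 := by rintro rfl; simp at hf
  have hA' : ∀ f : F[X], ∃ i < 3, f.coeff 0 ≠ 0 → X ^ i * f ∉ A := fun f ↦ by
    by_cases h : f.coeff 0 = 0
    · exact ⟨0, by simp, fun h' ↦ (h' h).elim⟩
    · obtain ⟨i, hi, h'⟩ := hA f (hne h)
      exact ⟨i, hi, fun _ ↦ h'⟩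
  choose i hi hiA using hA'
  set S := {f : F[X] | f ∈ degreeLT F (n + 1) ∧ f.coeff 0 ≠ 0}
  set M := (degreeLT F n : Set F[X]) \ ((X ^ 3 * ·) ⁻¹' A)
  have hS : S.Finite := (finite_degreeLT F (n + 1)).subset fun f hf ↦ hf.1
  have hM : M.Finite := (finite_degreeLT F n).subset Set.sdiff_subset
  have hinj : Set.InjOn (fun f ↦ X ^ i f * f) S :=
    fun f hf g hg h ↦ (eq_of_X_pow_mul_eq hf.2 hg.2 h).2
  rw [← hinj.ncard_image, ← Set.ncard_image_of_injective M
    (mul_right_injective₀ (pow_ne_zero 3 (X_ne_zero (R := F)))), ← Set.ncard_union_eq _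
    (hM.image _) (hS.image _)]
  · refine Set.ncard_le_ncard ?_ ((finite_degreeLT F (n + 3)).subset Set.sdiff_subset)
    rintro _ (⟨g, hg, rfl⟩ | ⟨f, hf, rfl⟩)
    · exact ⟨X_pow_mul_mem_degreeLT hg.1, hg.2⟩
    · refine ⟨degreeLT_mono ?_ (X_pow_mul_mem_degreeLT (k := i f) hf.1), hiA f hf.2⟩
      have := hi f
      omega
  · rw [Set.disjoint_left]
    rintro _ ⟨g, hg, rfl⟩ ⟨f, hf, h⟩
    have := congrArg (coeff · (i f)) h
    simp only [coeff_X_pow_mul', (hi f).not_ge] at this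
    simp [hf.2] at this

open Polynomial in
theorem ncard_degreeLT_le_ncard_diff {F : Type*} [Field F] [Fintype F] (n : ℕ) (A : Set F[X])
    (hA : ∀ f : F[X], f ≠ 0 → ∃ i < 3, X ^ i * f ∉ A) :
    ((Fintype.card F : ℝ) - 1) / ((Fintype.card F : ℝ) ^ 3 - 1) *
        ((Fintype.card F : ℝ) ^ n - (Fintype.card F : ℝ) ^ 2) ≤
      ((degreeLT F n : Set F[X]) \ A).ncard := by
  have hq : (1 : ℝ) < Fintype.card F := by exact_mod_cast Fintype.one_lt_card
  have hq3 : (0 : ℝ) < (Fintype.card F : ℝ) ^ 3 - 1 := sub_pos.2 (one_lt_pow₀ hq (by simp))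
  induction n using Nat.strong_induction_on generalizing A with
  | _ n ih =>
  obtain hn | ⟨m, rfl⟩ : n ≤ 2 ∨ ∃ m, n = m + 3 := by
    rcases Nat.lt_or_ge 2 n with h | h
    · exact .inr ⟨n - 3, by omega⟩
    · exact .inl h
  · refine (mul_nonpos_of_nonneg_of_nonpos (div_nonneg (by linarith) hq3.le) ?_).trans
      (Nat.cast_nonneg _)
    exact sub_nonpos.2 (pow_le_pow_right₀ hq.le hn)
  · have h1 := ih m (by omega) ((X ^ 3 * ·) ⁻¹' A) fun f hf ↦ by
      obtain ⟨i, hi, h⟩ := hA (X ^ 3 * f) (mul_ne_zero (pow_ne_zero _ X_ne_zero) hf)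
      exact ⟨i, hi, by rwa [Set.mem_preimage, mul_left_comm]⟩
    have h2 : ((_ + _ : ℕ) : ℝ) ≤ _ := Nat.cast_le.2 (ncard_diff_add_le A hA m)
    have h3 : ((_ ^ _ : ℕ) : ℝ) ≤ ((_ + _ : ℕ) : ℝ) :=
      Nat.cast_le.2 (ncard_degreeLT_coeff_zero_ne F m)
    push_cast at h2 h3
    refine le_trans ?_ h2
    refine le_trans (le_of_eq ?_) (add_le_add h1 (sub_le_iff_le_add.2 h3))
    field_simp
    ring

theorem stmt_15 (F : Type*) [Field F] [Fintype F] (q : ℕ) (hq : Fintype.card F = q)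
    (A : Set (Polynomial F)) (hA : ∀ f ∈ A, f ≠ 0)
    (hfree : ¬ ∃ b r : Polynomial F, b ≠ 0 ∧ r ≠ 0 ∧ ¬ IsUnit r ∧
      b ∈ A ∧ r * b ∈ A ∧ r ^ 2 * b ∈ A) :
    Filter.limsup
      (fun N : ℕ =>
        (Set.ncard {f : Polynomial F | f ∈ A ∧ f.natDegree ≤ N} : ℝ) / (q : ℝ) ^ (N + 1))
      Filter.atTop ≤
    1 - ((q : ℝ) - 1) / ((q : ℝ) ^ 3 - 1) := by
  have hfree' : ∀ f : Polynomial F, f ≠ 0 → ∃ i < 3, Polynomial.X ^ i * f ∉ A := by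
    intro f hf
    by_contra! h
    exact hfree ⟨f, Polynomial.X, hf, Polynomial.X_ne_zero, Polynomial.not_isUnit_X,
      by simpa using h 0, by simpa using h 1, h 2 (by simp)⟩
  have hq1 : (1 : ℝ) < q := by rw [← hq]; exact_mod_cast Fintype.one_lt_card
  set c : ℝ := ((q : ℝ) - 1) / ((q : ℝ) ^ 3 - 1)
  have hset (N : ℕ) : {f : Polynomial F | f ∈ A ∧ f.natDegree ≤ N} =
      (Polynomial.degreeLT F (N + 1) : Set (Polynomial F)) ∩ A := by
    ext f
    rw [Set.mem_inter_iff, SetLike.mem_coe, Polynomial.mem_degreeLT,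
      Polynomial.degree_lt_iff_coeff_zero, Set.mem_ofPred_eq,
      Polynomial.natDegree_le_iff_coeff_eq_zero, and_comm]
    rfl
  have hbound (N : ℕ) :
      (Set.ncard {f : Polynomial F | f ∈ A ∧ f.natDegree ≤ N} : ℝ) / (q : ℝ) ^ (N + 1) ≤
        1 - c + c * q ^ 2 * ((q : ℝ)⁻¹) ^ (N + 1) := by
    have h1 := ncard_degreeLT_le_ncard_diff (N + 1) A hfree'
    have h2 : ((_ + _ : ℕ) : ℝ) = _ := congrArg Nat.cast
      (Set.ncard_inter_add_ncard_sdiff_eq_ncard _ A (finite_degreeLT F (N + 1)))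
    rw [ncard_degreeLT] at h2
    rw [hq] at h1 h2
    push_cast at h2
    have hpow : (0 : ℝ) < (q : ℝ) ^ (N + 1) := by positivity
    rw [hset, div_le_iff₀ hpow, add_mul, mul_assoc _ _ ((q : ℝ) ^ (N + 1)), ← mul_pow,
      inv_mul_cancel₀ (by positivity), one_pow]
    linarith
  have hlim : Filter.Tendsto (fun N : ℕ ↦ 1 - c + c * q ^ 2 * ((q : ℝ)⁻¹) ^ (N + 1))
      Filter.atTop (nhds (1 - c)) := by
    have := (tendsto_pow_atTop_nhds_zero_of_lt_one (inv_nonneg.2 (zero_le_one.trans hq1.le))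
      (inv_lt_one_of_one_lt₀ hq1)).comp (Filter.tendsto_add_atTop_nat 1)
    simpa using (this.const_mul (c * q ^ 2)).const_add (1 - c)
  rw [← hlim.limsup_eq]
  refine Filter.limsup_le_limsup (Filter.Eventually.of_forall hbound) ?_ hlim.isBoundedUnder_le
  exact (Filter.isBoundedUnder_of ⟨0, fun N ↦ by positivity⟩).isCoboundedUnder_le
end

section
/- Let F be a finite field with q elements, and let m(n,q) be the number of monic irreducible polynomials of degree n in F[X]. Then the doubly infinite product ∏_{i=1}^∞ ∏_{n=1}^∞ (1 + q^(−3^i·n))^{m(n,q)} converges and equals ∏_{i=1}^∞ (1 − q^(1−2·3^i))/(1 − q^(1−3^i)). -/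
/-- the number of monic irreducible polynomials of degree `n` over `F` -/
noncomputable def numMonicIrred (F : Type*) [Field F] [Fintype F] (n : ℕ) : ℕ :=
  Nat.card {p : Polynomial F // p.Monic ∧ Irreducible p ∧ p.natDegree = n}

open Polynomial UniqueFactorizationMonoid

/-- Gauss's formula for the number of monic irreducible polynomials over a finite field. -/
theorem sum_divisors_mul_numMonicIrred (F : Type*) [Field F] [Fintype F] {N : ℕ} (hN : N ≠ 0) :
    ∑ d ∈ N.divisors, d * numMonicIrred F d = Fintype.card F ^ N := by
  classical
  obtain ⟨p, hp⟩ := CharP.exists F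
  set f : F[X] := X ^ Fintype.card F ^ N - X
  have hq : 1 < Fintype.card F := Fintype.one_lt_card
  have hdeg : f.natDegree = Fintype.card F ^ N :=
    FiniteField.X_pow_card_pow_sub_X_natDegree_eq F hN hq
  have hf0 : f ≠ 0 := FiniteField.X_pow_card_pow_sub_X_ne_zero F hN hq
  have hmon : f.Monic := by
    refine monic_X_pow_sub ?_
    rw [degree_X]
    exact_mod_cast Nat.one_lt_pow hN hq
  have hpq : p ∣ Fintype.card F ^ N := by
    rw [← CharP.cast_eq_zero_iff F p, Nat.cast_pow, FiniteField.cast_card_eq_zero, zero_pow hN]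
  have hnodup : (normalizedFactors f).Nodup :=
    (squarefree_iff_nodup_normalizedFactors hf0).1 (galois_poly_separable p _ hpq).squarefree
  have hmem (g : F[X]) :
      g ∈ (normalizedFactors f).toFinset ↔ Irreducible g ∧ g.Monic ∧ g.natDegree ∣ N := by
    rw [Multiset.mem_toFinset, Polynomial.mem_normalizedFactors_iff hf0]
    refine and_congr_right fun hg => and_congr_right fun _ => ?_
    rw [hg.natDegree_dvd_iff_dvd_X_pow_card_pow_sub_X, Nat.card_eq_fintype_card]
  have hsum : ∑ g ∈ (normalizedFactors f).toFinset, g.natDegree = Fintype.card F ^ N := by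
    have hprod := prod_normalizedFactors_eq hf0
    rw [hmon.normalize_eq_self] at hprod
    rw [← hdeg, Finset.sum, Multiset.toFinset_val, hnodup.dedup,
      ← natDegree_multiset_prod_of_monic _ fun g hg =>
        ((Polynomial.mem_normalizedFactors_iff hf0).1 hg).2.1, hprod]
  rw [← hsum, ← Finset.sum_fiberwise_of_maps_to (t := N.divisors) (g := natDegree)
    fun g hg => Nat.mem_divisors.2 ⟨((hmem g).1 hg).2.2, hN⟩]
  refine Finset.sum_congr rfl fun d hd => ?_
  rw [Finset.sum_congr rfl fun g hg => (Finset.mem_filter.1 hg).2, Finset.sum_const, smul_eq_mul,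
    mul_comm, numMonicIrred]
  congr 1
  refine Nat.subtype_card _ fun g => ?_
  rw [Finset.mem_filter, hmem]
  have := Nat.dvd_of_mem_divisors hd
  constructor
  · rintro ⟨⟨h1, h2, -⟩, h4⟩
    exact ⟨h2, h1, h4⟩
  · rintro ⟨h2, h1, rfl⟩
    exact ⟨⟨h1, h2, this⟩, rfl⟩

/-- `-log (1 - x)` as a power series indexed by the positive natural numbers. -/
theorem hasSum_pnat_pow_div {x : ℝ} (hx : |x| < 1) :
    HasSum (fun k : ℕ+ => x ^ (k : ℕ) / (k : ℕ)) (-Real.log (1 - x)) := by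
  rw [← Equiv.pnatEquivNat.symm.hasSum_iff]
  convert Real.hasSum_pow_div_log_of_abs_lt_one hx using 2 with k
  simp

/-- The logarithm of the Euler product of the zeta function of `F[X]`. -/
theorem hasSum_numMonicIrred_mul_log (F : Type*) [Field F] [Fintype F] {u : ℝ} (hu : 0 ≤ u)
    (hqu : Fintype.card F * u < 1) :
    HasSum (fun n : ℕ+ => numMonicIrred F n * -Real.log (1 - u ^ (n : ℕ)))
      (-Real.log (1 - Fintype.card F * u)) := by
  have hq : (1 : ℝ) ≤ Fintype.card F := by exact_mod_cast Fintype.card_pos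
  have hu1 : u < 1 := by nlinarith
  let f : ℕ+ × ℕ+ → ℝ := fun x =>
    numMonicIrred F x.1 * ((u ^ (x.1 : ℕ)) ^ (x.2 : ℕ) / (x.2 : ℕ))
  have hnonneg (x) : 0 ≤ f x := by positivity
  have hN : HasSum (fun N : ℕ+ => (Fintype.card F * u) ^ (N : ℕ) / (N : ℕ))
      (-Real.log (1 - Fintype.card F * u)) :=
    hasSum_pnat_pow_div (by rwa [abs_of_nonneg (by positivity)])
  have hfiber (N : ℕ+) :
      HasSum (fun c : (N : ℕ).divisorsAntidiagonal => f (sigmaAntidiagonalEquivProd ⟨N, c⟩))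
        ((Fintype.card F * u) ^ (N : ℕ) / (N : ℕ)) := by
    have hterm (c : (N : ℕ).divisorsAntidiagonal) : f (sigmaAntidiagonalEquivProd ⟨N, c⟩) =
        (c.1.1 * numMonicIrred F c.1.1 : ℕ) * (u ^ (N : ℕ) / (N : ℕ)) := by
      obtain ⟨⟨a, b⟩, hc⟩ := c
      obtain ⟨hab, h0⟩ := Nat.mem_divisorsAntidiagonal.1 hc
      change (numMonicIrred F a : ℝ) * ((u ^ a) ^ b / b) = _
      simp only at hab ⊢
      have ha : (a : ℝ) ≠ 0 := Nat.cast_ne_zero.2 (left_ne_zero_of_mul (hab ▸ h0))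
      have hb : (b : ℝ) ≠ 0 := Nat.cast_ne_zero.2 (right_ne_zero_of_mul (hab ▸ h0))
      rw [← hab, ← pow_mul]
      push_cast
      field_simp
    have hval : ∑ c : (N : ℕ).divisorsAntidiagonal, f (sigmaAntidiagonalEquivProd ⟨N, c⟩) =
        (Fintype.card F * u) ^ (N : ℕ) / (N : ℕ) := by
      simp_rw [hterm]
      rw [← Finset.sum_mul, Finset.sum_coe_sort (N : ℕ).divisorsAntidiagonal
        (fun c => ((c.1 * numMonicIrred F c.1 : ℕ) : ℝ)),
        Nat.sum_divisorsAntidiagonal (fun a _ => ((a * numMonicIrred F a : ℕ) : ℝ)),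
        ← Nat.cast_sum, sum_divisors_mul_numMonicIrred F N.ne_zero, mul_pow]
      push_cast
      ring
    rw [← hval]
    exact hasSum_fintype _
  have hsummable : Summable (f ∘ sigmaAntidiagonalEquivProd) := by
    refine (summable_sigma_of_nonneg fun x => hnonneg _).2 ⟨fun N => (hfiber N).summable, ?_⟩
    exact hN.summable.congr fun N => (hfiber N).tsum_eq.symm
  have hf : HasSum f (-Real.log (1 - Fintype.card F * u)) :=
    sigmaAntidiagonalEquivProd.hasSum_iff.1 (hN.sigma_of_hasSum hfiber hsummable)
  refine hf.prod_fiberwise fun n => (hasSum_pnat_pow_div ?_).mul_left _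
  rw [abs_of_nonneg (by positivity)]
  exact pow_lt_one₀ hu hu1 n.ne_zero

/-- The quotient `ζ(s) / ζ(2s)` of zeta functions of `F[X]`, in the variable `u = q ^ (-s)`, as an
Euler product. -/
theorem hasProd_one_add_pow_numMonicIrred (F : Type*) [Field F] [Fintype F] {u : ℝ} (hu : 0 < u)
    (hqu : Fintype.card F * u < 1) :
    HasProd (fun n : ℕ => (1 + u ^ (n + 1)) ^ numMonicIrred F (n + 1))
      ((1 - Fintype.card F * u ^ 2) / (1 - Fintype.card F * u)) := by
  have hq : (1 : ℝ) ≤ Fintype.card F := by exact_mod_cast Fintype.card_pos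
  have hu1 : u < 1 := by nlinarith
  have hqu2 : Fintype.card F * u ^ 2 < 1 := by nlinarith
  have h := ((hasSum_numMonicIrred_mul_log F hu.le hqu).sub
    (hasSum_numMonicIrred_mul_log F (sq_nonneg u) hqu2)).rexp
  rw [← Equiv.pnatEquivNat.symm.hasProd_iff] at h
  convert h using 1
  · ext n
    have hn : u ^ (n + 1) < 1 := pow_lt_one₀ hu.le hu1 n.succ_ne_zero
    have hpos : 0 < u ^ (n + 1) := by positivity
    have hlog : Real.log (1 - (u ^ 2) ^ (n + 1)) =
        Real.log (1 - u ^ (n + 1)) + Real.log (1 + u ^ (n + 1)) := by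
      rw [← Real.log_mul (by linarith) (by linarith)]
      congr 1
      ring
    simp only [Function.comp_apply, Equiv.pnatEquivNat_symm_apply, Nat.succPNat_coe,
      Nat.succ_eq_add_one, hlog]
    rw [← Real.exp_log (show 0 < 1 + u ^ (n + 1) by linarith), ← Real.exp_nat_mul,
      Real.exp_log (by linarith)]
    congr 1
    ring
  · rw [neg_sub_neg, Real.exp_sub, Real.exp_log (by linarith), Real.exp_log (by linarith)]

theorem multipliable_one_sub_zpow_div {q : ℝ} (hq : 2 ≤ q) :
    Multipliable fun i : ℕ =>
      (1 - q ^ ((1 : ℤ) - 2 * 3 ^ (i + 1))) / (1 - q ^ ((1 : ℤ) - 3 ^ (i + 1))) := by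
  have hbound (i : ℕ) : q ^ ((1 : ℤ) - 3 ^ (i + 1)) ≤ (1 / 2) ^ (i + 1) := by
    have h3 : ((i + 1 : ℕ) : ℤ) ≤ 3 ^ (i + 1) - 1 := by
      have := Nat.lt_pow_self (n := i + 1) (show 1 < 3 by norm_num)
      zify at this
      push_cast at this ⊢
      linarith
    calc q ^ ((1 : ℤ) - 3 ^ (i + 1)) ≤ q ^ (-((i + 1 : ℕ) : ℤ)) :=
          zpow_le_zpow_right₀ (by linarith) (by linarith)
      _ = (1 / q) ^ (i + 1) := by rw [zpow_neg, zpow_natCast, one_div, inv_pow]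
      _ ≤ (1 / 2) ^ (i + 1) := by gcongr
  have hsummable : Summable fun i : ℕ =>
      (q ^ ((1 : ℤ) - 3 ^ (i + 1)) - q ^ ((1 : ℤ) - 2 * 3 ^ (i + 1))) /
        (1 - q ^ ((1 : ℤ) - 3 ^ (i + 1))) := by
    refine Summable.of_nonneg_of_le (fun i => ?_) (fun i => ?_)
      (summable_geometric_of_lt_one (r := (1 / 2 : ℝ)) (by norm_num) (by norm_num))
    all_goals
      have hle := hbound i
      have hhalf : ((1 : ℝ) / 2) ^ i ≤ 1 := pow_le_one₀ (by norm_num) (by norm_num)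
      have hpos : 0 < q ^ ((1 : ℤ) - 2 * 3 ^ (i + 1)) := zpow_pos (by linarith) _
      have hmono : q ^ ((1 : ℤ) - 2 * 3 ^ (i + 1)) ≤ q ^ ((1 : ℤ) - 3 ^ (i + 1)) :=
        zpow_le_zpow_right₀ (by linarith) (by
          have : (0 : ℤ) < 3 ^ (i + 1) := by positivity
          linarith)
      rw [pow_succ (1 / 2 : ℝ)] at hle
    · exact div_nonneg (by linarith) (by linarith)
    · rw [div_le_iff₀ (by linarith)]
      nlinarith
  refine (Real.multipliable_one_add_of_summable hsummable).congr fun i => ?_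
  have hlt : q ^ ((1 : ℤ) - 3 ^ (i + 1)) < 1 :=
    (hbound i).trans_lt (pow_lt_one₀ (by norm_num) (by norm_num) i.succ_ne_zero)
  rw [one_add_div (by linarith)]
  ring

theorem stmt_17 (F : Type*) [Field F] [Fintype F] (q : ℕ) (hq : Fintype.card F = q) :
    ∃ L : ℝ,
      (∀ i : ℕ, Multipliable (fun n : ℕ =>
        (1 + (q : ℝ) ^ (-((3 : ℤ) ^ (i + 1) * (n + 1)))) ^ numMonicIrred F (n + 1))) ∧
      HasProd (fun i : ℕ =>
        ∏' n : ℕ,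
          (1 + (q : ℝ) ^ (-((3 : ℤ) ^ (i + 1) * (n + 1)))) ^ numMonicIrred F (n + 1)) L ∧
      HasProd (fun i : ℕ =>
        (1 - (q : ℝ) ^ ((1 : ℤ) - 2 * 3 ^ (i + 1))) /
          (1 - (q : ℝ) ^ ((1 : ℤ) - 3 ^ (i + 1)))) L := by
  have hq2 : (2 : ℝ) ≤ q := by exact_mod_cast hq ▸ Fintype.one_lt_card (α := F)
  have hq0 : (q : ℝ) ≠ 0 := by linarith
  have key (i : ℕ) : HasProd (fun n : ℕ =>
      (1 + (q : ℝ) ^ (-((3 : ℤ) ^ (i + 1) * (n + 1)))) ^ numMonicIrred F (n + 1))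
      ((1 - (q : ℝ) ^ ((1 : ℤ) - 2 * 3 ^ (i + 1))) /
        (1 - (q : ℝ) ^ ((1 : ℤ) - 3 ^ (i + 1)))) := by
    have hqu : (q : ℝ) * (q : ℝ) ^ (-(3 : ℤ) ^ (i + 1)) = (q : ℝ) ^ ((1 : ℤ) - 3 ^ (i + 1)) := by
      rw [sub_eq_add_neg, zpow_add₀ hq0, zpow_one]
    have hqu2 : (q : ℝ) * ((q : ℝ) ^ (-(3 : ℤ) ^ (i + 1))) ^ 2 =
        (q : ℝ) ^ ((1 : ℤ) - 2 * 3 ^ (i + 1)) := by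
      rw [sub_eq_add_neg, zpow_add₀ hq0, zpow_one, ← zpow_natCast, ← zpow_mul]
      congr 2
      push_cast
      ring
    have hlt : (q : ℝ) * (q : ℝ) ^ (-(3 : ℤ) ^ (i + 1)) < 1 := by
      rw [hqu]
      refine zpow_lt_one_of_neg₀ (by linarith) ?_
      exact sub_neg.2 (one_lt_pow₀ (by norm_num) i.succ_ne_zero)
    have h := hasProd_one_add_pow_numMonicIrred F
      (u := (q : ℝ) ^ (-(3 : ℤ) ^ (i + 1))) (by positivity) (by rwa [hq])
    rw [hq, hqu, hqu2] at h
    convert h using 4 with n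
    rw [← zpow_natCast, ← zpow_mul]
    congr 1
    push_cast
    ring
  obtain ⟨L, hL⟩ := multipliable_one_sub_zpow_div hq2
  refine ⟨L, fun i => (key i).multipliable, ?_, hL⟩
  simpa only [(key _).tprod_eq] using hL
end
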